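/- arXiv:2501.00429 — 2 statements merged into one kernel-verified Lean document; each statement's English description precedes it below -/
import Mathlib

section
/- (Weyl-type change of variables for tubular coordinates) With Γ, M, N_l, g, G̃(l) and y(u,r) = M(u) + Σ_{l=k+1}^d r^l N_l(u) as in the context, let ε > 0, let B(ε) ⊆ ℝ^{d−k} be the closed Euclidean ball of radius ε, and suppose y is injective on Γ × B(ε). Then for every Lebesgue-integrable function φ on the image T(ε) = y(Γ × B(ε)) one has ∫_{T(ε)} φ(x) dx = ∫_Γ ∫_{B(ε)} φ(y(u,r)) · |det( I_k + Σ_{l=k+1}^d r^l G̃(l)(u) )| · √(det g(u)) dr du. -/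
open Set Metric MeasureTheory
open scoped RealInnerProductSpace

noncomputable section

abbrev Euc (n : ℕ) := EuclideanSpace ℝ (Fin n)

variable {k m : ℕ}

/-- The partial derivative `∂M/∂uⁱ` of a map between Euclidean spaces. -/
def pd {n n' : ℕ} (M : Euc n → Euc n') (u : Euc n) (i : Fin n) : Euc n' :=
  fderiv ℝ M u (EuclideanSpace.basisFun (Fin n) ℝ i)

/-- The Gram matrix (first fundamental form) `g_{ij} = ∂M/∂uⁱ · ∂M/∂uʲ`. -/
def gram (M : Euc k → Euc (k + m)) (u : Euc k) : Matrix (Fin k) (Fin k) ℝ :=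
  Matrix.of fun i j => ⟪pd M u i, pd M u j⟫

/-- The matrix `G(l)` with entries `G_{ij}(l) = ∂M/∂uⁱ · ∂N_l/∂uʲ`. -/
def secondG (M : Euc k → Euc (k + m)) (N : Fin m → Euc k → Euc (k + m)) (l : Fin m)
    (u : Euc k) : Matrix (Fin k) (Fin k) ℝ :=
  Matrix.of fun i j => ⟪pd M u i, pd (N l) u j⟫

/-- The matrix `G̃(l) = g⁻¹ G(l)`. -/
def tildeG (M : Euc k → Euc (k + m)) (N : Fin m → Euc k → Euc (k + m)) (l : Fin m)
    (u : Euc k) : Matrix (Fin k) (Fin k) ℝ :=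
  (gram M u)⁻¹ * secondG M N l u

/-- The tubular-coordinate map `y(u, r) = M(u) + Σ_l r^l N_l(u)`. -/
def tubularMap (M : Euc k → Euc (k + m)) (N : Fin m → Euc k → Euc (k + m)) :
    Euc k × Euc m → Euc (k + m) :=
  fun p => M p.1 + ∑ l, p.2 l • N l p.1

/-- The `b`-th standard basis vector of `ℝ^k × ℝ^m`, with the first `k` indices in the
`u`-directions and the last `m` indices in the `r`-directions. -/
def prodBasisVec (k m : ℕ) (b : Fin (k + m)) : Euc k × Euc m :=
  Sum.elim (fun i => (EuclideanSpace.basisFun (Fin k) ℝ i, 0))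
    (fun l => (0, EuclideanSpace.basisFun (Fin m) ℝ l)) (finSumFinEquiv.symm b)

/-- The `(k+m) × (k+m)` Jacobian matrix of the tubular-coordinate map `y` at `(u, r)`,
in standard bases. -/
def tubularJacobian (M : Euc k → Euc (k + m)) (N : Fin m → Euc k → Euc (k + m))
    (u : Euc k) (r : Euc m) : Matrix (Fin (k + m)) (Fin (k + m)) ℝ :=
  Matrix.of fun a b => fderiv ℝ (tubularMap M N) (u, r) (prodBasisVec k m b) a

lemma finAdd_mp (k m : ℕ) :
    MeasurePreserving (EuclideanSpace.finAddEquivProd (𝕜 := ℝ) (n := k) (m := m))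
      volume volume := by
  have h1 := (LinearIsometryEquiv.piLpCongrLeft 2 ℝ ℝ
    (finSumFinEquiv (m := k) (n := m)).symm).measurePreserving
  have h2 := (PiLp.sumPiLpEquivProdLpPiLp (𝕜 := ℝ) (ι := Fin k) (κ := Fin m) 2
    (fun _ => ℝ)).measurePreserving
  have h3 := WithLp.volume_preserving_ofLp (Euc k) (Euc m)
  exact h3.comp (h2.comp h1)

lemma finAdd_inl (k m : ℕ) (i : Fin k) :
    EuclideanSpace.finAddEquivProd (𝕜 := ℝ) (n := k) (m := m)
      (EuclideanSpace.basisFun (Fin (k+m)) ℝ (finSumFinEquiv (Sum.inl i)))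
      = (EuclideanSpace.basisFun (Fin k) ℝ i, 0) := by
  ext j
  · simp [EuclideanSpace.single_apply, Pi.single_apply, PiLp.single_apply]
  · simp [EuclideanSpace.single_apply, Pi.single_apply, PiLp.single_apply]

lemma finAdd_inr (k m : ℕ) (i : Fin m) :
    EuclideanSpace.finAddEquivProd (𝕜 := ℝ) (n := k) (m := m)
      (EuclideanSpace.basisFun (Fin (k+m)) ℝ (finSumFinEquiv (Sum.inr i)))
      = (0, EuclideanSpace.basisFun (Fin m) ℝ i) := by
  ext j
  · simp [EuclideanSpace.single_apply, Pi.single_apply, PiLp.single_apply]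
  · simp [EuclideanSpace.single_apply, Pi.single_apply, PiLp.single_apply]

/-- Derivative of the tubular map. -/
lemma tubular_hasFDerivAt {k m : ℕ} {M : Euc k → Euc (k + m)}
    {N : Fin m → Euc k → Euc (k + m)} {u : Euc k} (r : Euc m)
    (hM : DifferentiableAt ℝ M u) (hN : ∀ l, DifferentiableAt ℝ (N l) u) :
    HasFDerivAt (tubularMap M N)
      ((fderiv ℝ M u).comp (ContinuousLinearMap.fst ℝ (Euc k) (Euc m)) +
        ∑ l, (r l • (fderiv ℝ (N l) u).comp (ContinuousLinearMap.fst ℝ (Euc k) (Euc m)) +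
          ((EuclideanSpace.proj (𝕜 := ℝ) l).comp
            (ContinuousLinearMap.snd ℝ (Euc k) (Euc m))).smulRight (N l u))) (u, r) := by
  unfold tubularMap
  have hf : HasFDerivAt (fun p : Euc k × Euc m => p.1)
    (ContinuousLinearMap.fst ℝ (Euc k) (Euc m)) (u, r) := hasFDerivAt_fst
  have hM' : HasFDerivAt M (fderiv ℝ M u) ((u, r) : Euc k × Euc m).1 := hM.hasFDerivAt
  refine (hM'.comp (u, r) hf).add (HasFDerivAt.fun_sum fun l _ => ?_)
  have hN' : HasFDerivAt (N l) (fderiv ℝ (N l) u) ((u, r) : Euc k × Euc m).1 :=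
    (hN l).hasFDerivAt
  have hs : HasFDerivAt (fun p : Euc k × Euc m => p.2 l)
    ((EuclideanSpace.proj (𝕜 := ℝ) l).comp
            (ContinuousLinearMap.snd ℝ (Euc k) (Euc m))) (u, r) :=
    ((EuclideanSpace.proj (𝕜 := ℝ) l).comp
            (ContinuousLinearMap.snd ℝ (Euc k) (Euc m))).hasFDerivAt
  exact hs.smul (hN'.comp (u, r) hf)

lemma matrix_part {k m : ℕ} (L : Euc (k+m) →L[ℝ] Euc (k+m))
    (a v : Fin k → Euc (k+m)) (n : Fin m → Euc (k+m))
    (hL1 : ∀ i, L (EuclideanSpace.basisFun (Fin (k+m)) ℝ (finSumFinEquiv (Sum.inl i))) = v i)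
    (hL2 : ∀ i, L (EuclideanSpace.basisFun (Fin (k+m)) ℝ (finSumFinEquiv (Sum.inr i))) = n i)
    (ha : LinearIndependent ℝ a)
    (horth : ∀ i l, ⟪a i, n l⟫ = 0)
    (honb : ∀ l l', ⟪n l, n l'⟫ = if l = l' then 1 else 0) :
    0 < (Matrix.gram ℝ a).det ∧
    √(Matrix.gram ℝ a).det * |L.det| = |(Matrix.of fun i j => ⟪a i, v j⟫).det| := by
  have hg : 0 < (Matrix.gram ℝ a).det := (Matrix.posDef_gram_of_linearIndependent ha).det_pos
  refine ⟨hg, ?_⟩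
  let P : Matrix (Fin k ⊕ Fin m) (Fin k ⊕ Fin m) ℝ :=
    Matrix.of fun x y => (Sum.elim a n y) (finSumFinEquiv x)
  let A : Matrix (Fin k ⊕ Fin m) (Fin k ⊕ Fin m) ℝ :=
    Matrix.of fun x y => (Sum.elim v n y) (finSumFinEquiv x)
  have key : ∀ x y : Euc (k+m),
      ∑ c : Fin k ⊕ Fin m, x (finSumFinEquiv c) * y (finSumFinEquiv c) = ⟪x, y⟫ := by
    intro x y
    rw [Equiv.sum_comp finSumFinEquiv (fun c => x c * y c), PiLp.inner_apply]
    simp [mul_comm]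
  have hdet : L.det = A.det := by
    have := LinearMap.det_toMatrix
      ((EuclideanSpace.basisFun (Fin (k+m)) ℝ).toBasis.reindex finSumFinEquiv.symm)
      (L : Euc (k+m) →ₗ[ℝ] Euc (k+m))
    rw [ContinuousLinearMap.det, ← this]
    congr 1
    ext x y
    rw [LinearMap.toMatrix_apply]
    rcases y with y | y
    · simpa [A] using congrArg (fun z => z.ofLp (finSumFinEquiv x)) (hL1 y)
    · simpa [A] using congrArg (fun z => z.ofLp (finSumFinEquiv x)) (hL2 y)
  have h1 : P.transpose * P = Matrix.fromBlocks (Matrix.gram ℝ a) 0 0 1 := by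
    ext x y
    rw [Matrix.mul_apply]
    simp only [P, Matrix.transpose_apply, Matrix.of_apply]
    rw [key]
    rcases x with x | x <;> rcases y with y | y
    · simp [Matrix.gram_apply]
    · simp [horth]
    · simp [horth, real_inner_comm]
    · simp [honb, Matrix.one_apply]
  have h2 : P.transpose * A = Matrix.fromBlocks (Matrix.of fun i j => ⟪a i, v j⟫) 0
      (Matrix.of fun i j => ⟪n i, v j⟫) 1 := by
    ext x y
    rw [Matrix.mul_apply]
    simp only [P, A, Matrix.transpose_apply, Matrix.of_apply]
    rw [key]
    rcases x with x | x <;> rcases y with y | y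
    · simp
    · simp [horth]
    · simp
    · simp [honb, Matrix.one_apply]
  have h1' := congrArg Matrix.det h1
  have h2' := congrArg Matrix.det h2
  rw [Matrix.det_fromBlocks_zero₁₂, Matrix.det_mul, Matrix.det_transpose, Matrix.det_one,
    mul_one] at h1' h2'
  rw [hdet, ← h1', ← h2', Real.sqrt_mul_self_eq_abs, abs_mul]

lemma jac_eq {k m : ℕ} {M : Euc k → Euc (k + m)}
    {N : Fin m → Euc k → Euc (k + m)} {u : Euc k} (r : Euc m)
    (hM : DifferentiableAt ℝ M u) (hN : ∀ l, DifferentiableAt ℝ (N l) u)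
    (hrank : LinearIndependent ℝ (fun i : Fin k => pd M u i))
    (horth : ∀ (i : Fin k) (l : Fin m), ⟪pd M u i, N l u⟫ = 0)
    (honb : ∀ l l' : Fin m, ⟪N l u, N l' u⟫ = if l = l' then 1 else 0) :
    |((fderiv ℝ (tubularMap M N) (u, r)).comp
      (EuclideanSpace.finAddEquivProd (𝕜 := ℝ) (n := k) (m := m)).toContinuousLinearMap).det|
      = |(1 + ∑ l, r l • tildeG M N l u).det| * Real.sqrt (gram M u).det := by
  obtain ⟨hg, h⟩ := matrix_part ((fderiv ℝ (tubularMap M N) (u, r)).comp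
      (EuclideanSpace.finAddEquivProd (𝕜 := ℝ) (n := k) (m := m)).toContinuousLinearMap)
      (fun i => pd M u i) (fun i => pd M u i + ∑ l, r l • pd (N l) u i) (fun l => N l u)
      (by
        intro i
        rw [ContinuousLinearMap.comp_apply, ContinuousLinearEquiv.coe_coe, finAdd_inl,
          (tubular_hasFDerivAt r hM hN).fderiv]
        simp [pd, -EuclideanSpace.basisFun_apply])
      (by
        intro i
        rw [ContinuousLinearMap.comp_apply, ContinuousLinearEquiv.coe_coe, finAdd_inr,
          (tubular_hasFDerivAt r hM hN).fderiv]
        simp [PiLp.single_apply])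
      hrank horth honb
  have hgr : Matrix.gram ℝ (fun i => pd M u i) = gram M u := rfl
  rw [hgr] at hg h
  have hfac : (Matrix.of fun i j => ⟪pd M u i, pd M u j + ∑ l, r l • pd (N l) u j⟫)
      = gram M u * (1 + ∑ l, r l • tildeG M N l u) := by
    have hu : IsUnit (gram M u).det := hg.ne'.isUnit
    rw [mul_add, mul_one, Finset.mul_sum]
    have : ∀ l, gram M u * (r l • tildeG M N l u) = r l • secondG M N l u := by
      intro l
      rw [Matrix.mul_smul, tildeG, Matrix.mul_nonsing_inv_cancel_left _ _ hu]
    simp only [this]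
    ext i j
    simp [gram, secondG, inner_add_right, inner_sum, real_inner_smul_right, Matrix.sum_apply]
  rw [hfac, Matrix.det_mul, abs_mul, abs_of_pos hg] at h
  have hs : 0 < √(gram M u).det := Real.sqrt_pos.2 hg
  have hss := Real.mul_self_sqrt hg.le
  apply mul_left_cancel₀ hs.ne'
  rw [h]
  nth_rewrite 1 [← hss]
  ring

/-- Weyl-type change of variables in tubular coordinates. If `y` is
injective on `Γ × B(ε)`, then for every function `φ` integrable on
`T(ε) = y(Γ × B(ε))`,
`∫_{T(ε)} φ = ∫_Γ ∫_{B(ε)} φ(y(u,r)) |det(I + Σ_l r^l G̃(l)(u))| √(det g(u)) dr du`. -/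
theorem tubular_change_of_variables
    (k m : ℕ) (Γ : Set (Euc k)) (M : Euc k → Euc (k + m))
    (N : Fin m → Euc k → Euc (k + m)) (ε : ℝ)
    (hΓ : IsOpen Γ) (hM : ContDiffOn ℝ 2 M Γ)
    (hrank : ∀ u ∈ Γ, LinearIndependent ℝ (fun i : Fin k => pd M u i))
    (hN : ∀ l, ContDiffOn ℝ 1 (N l) Γ)
    (horth : ∀ u ∈ Γ, ∀ (i : Fin k) (l : Fin m), ⟪pd M u i, N l u⟫ = 0)
    (honb : ∀ u ∈ Γ, ∀ l l' : Fin m, ⟪N l u, N l' u⟫ = if l = l' then 1 else 0)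
    (hε : 0 < ε)
    (hinj : InjOn (tubularMap M N) (Γ ×ˢ closedBall (0 : Euc m) ε))
    (φ : Euc (k + m) → ℝ)
    (hφ : IntegrableOn φ (tubularMap M N '' (Γ ×ˢ closedBall (0 : Euc m) ε))) :
    ∫ x in tubularMap M N '' (Γ ×ˢ closedBall (0 : Euc m) ε), φ x
      = ∫ u in Γ, ∫ r in closedBall (0 : Euc m) ε,
          φ (tubularMap M N (u, r)) * |(1 + ∑ l, r l • tildeG M N l u).det|
            * Real.sqrt (gram M u).det := by
  set e := EuclideanSpace.finAddEquivProd (𝕜 := ℝ) (n := k) (m := m) with he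
  set S : Set (Euc k × Euc m) := Γ ×ˢ closedBall (0 : Euc m) ε with hS
  have hSm : MeasurableSet S := hΓ.measurableSet.prod isClosed_closedBall.measurableSet
  have hMd : ∀ u ∈ Γ, DifferentiableAt ℝ M u := fun u hu =>
    (hM.differentiableOn (by norm_num)).differentiableAt (hΓ.mem_nhds hu)
  have hNd : ∀ u ∈ Γ, ∀ l, DifferentiableAt ℝ (N l) u := fun u hu l =>
    ((hN l).differentiableOn (by norm_num)).differentiableAt (hΓ.mem_nhds hu)
  have hmp : MeasurePreserving e volume volume := finAdd_mp k m
  have hemb : MeasurableEmbedding e := e.toHomeomorph.measurableEmbedding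
  have hs' : MeasurableSet (e ⁻¹' S) := e.continuous.measurable hSm
  have himg : tubularMap M N '' S = (tubularMap M N ∘ e) '' (e ⁻¹' S) := by
    rw [image_comp, image_preimage_eq _ e.surjective]
  have hder : ∀ x ∈ e ⁻¹' S, HasFDerivWithinAt (tubularMap M N ∘ e)
      ((fderiv ℝ (tubularMap M N) (e x)).comp e.toContinuousLinearMap) (e ⁻¹' S) x := by
    intro x hx
    have h1 : HasFDerivAt (tubularMap M N) (fderiv ℝ (tubularMap M N) (e x)) (e x) :=
      (tubular_hasFDerivAt (e x).2 (hMd _ hx.1) (hNd _ hx.1)).differentiableAt.hasFDerivAt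
    exact (h1.comp x e.hasFDerivAt).hasFDerivWithinAt
  have hinj' : InjOn (tubularMap M N ∘ e) (e ⁻¹' S) := by
    intro x hx y hy hxy
    exact e.injective (hinj hx hy hxy)
  set F : Euc k × Euc m → ℝ := fun p =>
    φ (tubularMap M N (p.1, p.2)) * |(1 + ∑ l, p.2 l • tildeG M N l p.1).det|
            * Real.sqrt (gram M p.1).det with hF
  have hcongr : ∀ x ∈ e ⁻¹' S,
      |((fderiv ℝ (tubularMap M N) (e x)).comp e.toContinuousLinearMap).det| •
        φ ((tubularMap M N ∘ e) x) = F (e x) := by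
    intro x hx
    have := jac_eq (e x).2 (hMd _ hx.1) (hNd _ hx.1) (hrank _ hx.1) (horth _ hx.1)
      (honb _ hx.1)
    rw [smul_eq_mul]
    refine (congrArg (· * φ ((tubularMap M N ∘ e) x)) this).trans ?_
    simp only [hF, Function.comp]
    ring
  have hint : IntegrableOn F S (volume.prod volume) := by
    rw [himg, integrableOn_image_iff_integrableOn_abs_det_fderiv_smul volume hs' hder hinj'] at hφ
    have h2 : IntegrableOn (F ∘ e) (e ⁻¹' S) := hφ.congr_fun hcongr hs'
    exact (hmp.integrableOn_comp_preimage hemb).1 h2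
  rw [himg, integral_image_eq_integral_abs_det_fderiv_smul volume hs' hder hinj',
    setIntegral_congr_fun hs' hcongr, hmp.setIntegral_preimage_emb hemb F S]
  exact setIntegral_prod F hint
end
end

section
/- Let V : ℝ^d → ℝ be convex, C², with min V = 0 and ∫_{ℝ^d} exp(−V(x)) dx < ∞. Then there exist constants c > 0 and ε₀ > 0, independent of the temperature, such that for every ε ∈ (0, ε₀] the Gibbs measure μ_ε with density exp(−V/ε)/Z_ε satisfies the Poincaré inequality PI(c); that is, for log-concave Gibbs measures the Poincaré constant is bounded below uniformly in the low-temperature regime. -/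
open MeasureTheory Real Filter Metric Set
open scoped RealInnerProductSpace ENNReal Topology

noncomputable section

variable {d : ℕ}

def localMinSet (V : Euc d → ℝ) : Set (Euc d) := {x | IsLocalMin V x}

def localMaxSet (V : Euc d → ℝ) : Set (Euc d) := {x | IsLocalMax V x}

def hessQ (V : Euc d → ℝ) (x v : Euc d) : ℝ := ⟪fderiv ℝ (gradient V) x v, v⟫

def lap (V : Euc d → ℝ) (x : Euc d) : ℝ :=
  ∑ i, hessQ V x (EuclideanSpace.basisFun (Fin d) ℝ i)

def PoincareIneq {d : ℕ} (μ : Measure (Euc d)) (ρ : ℝ) : Prop :=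
  ∀ f : Euc d → ℝ, ContDiff ℝ 1 f →
    Integrable (fun x => (f x) ^ 2) μ →
    Integrable (fun x => ‖gradient f x‖ ^ 2) μ →
    ∫ x, (f x - ∫ y, f y ∂μ) ^ 2 ∂μ ≤ (1 / ρ) * ∫ x, ‖gradient f x‖ ^ 2 ∂μ

def gibbs (V : Euc d → ℝ) (ε : ℝ) : Measure (Euc d) :=
  (ENNReal.ofReal (∫ x, exp (-V x / ε)))⁻¹ •
    volume.withDensity fun x => ENNReal.ofReal (exp (-V x / ε))

def gibbsOn (V : Euc d → ℝ) (ε : ℝ) (U : Set (Euc d)) : Measure (Euc d) :=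
  (ENNReal.ofReal (∫ x in U, exp (-V x / ε)))⁻¹ •
    (volume.restrict U).withDensity fun x => ENNReal.ofReal (exp (-V x / ε))

def uniformOn {d : ℕ} (U : Set (Euc d)) : Measure (Euc d) :=
  (volume U)⁻¹ • volume.restrict U

def Assumption1 (V : Euc d → ℝ) (ν : ℝ) (𝒩 : Set (Euc d) → Set (Euc d)) : Prop :=
  0 < ν ∧ ∀ x ∈ localMinSet V,
    IsOpen (𝒩 (connectedComponentIn (localMinSet V) x)) ∧
    connectedComponentIn (localMinSet V) x ⊆ 𝒩 (connectedComponentIn (localMinSet V) x) ∧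
    ContDiffOn ℝ 3 V (𝒩 (connectedComponentIn (localMinSet V) x)) ∧
    ∀ y ∈ 𝒩 (connectedComponentIn (localMinSet V) x),
      ν * (V y - sInf (V '' 𝒩 (connectedComponentIn (localMinSet V) x))) ≤ ‖gradient V y‖ ^ 2

def NSet (V : Euc d → ℝ) (𝒩 : Set (Euc d) → Set (Euc d)) : Set (Euc d) :=
  ⋃ x ∈ localMinSet V, 𝒩 (connectedComponentIn (localMinSet V) x)

def Assumption2 (V : Euc d → ℝ) (𝒩 : Set (Euc d) → Set (Euc d)) : Prop :=
  ∀ x ∉ NSet V 𝒩, gradient V x = 0 → ∀ v : Euc d, v ≠ 0 → hessQ V x v < 0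

def Assumption3 (V : Euc d → ℝ) (R₀ ν_eb C_g : ℝ) : Prop :=
  0 < R₀ ∧ 0 < ν_eb ∧ 0 < C_g ∧
  (∀ x : Euc d, R₀ ≤ ‖x‖ →
      ν_eb * infDist x (localMinSet V) ≤ ‖gradient V x‖ ∧ |lap V x| ≤ C_g * ‖x‖ ^ 2) ∧
  Tendsto V (cocompact (Euc d)) atTop ∧
  localMinSet V ⊆ closedBall 0 R₀


lemma aux_growth {d : ℕ} (V : Euc d → ℝ) (hV : Continuous V)
    (hconv : ConvexOn ℝ univ V) (x0 : Euc d) (hx0 : V x0 = 0)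
    (hZ : Integrable (fun x => exp (-V x))) :
    ∃ R : ℝ, 1 ≤ R ∧ ∀ x, R ≤ ‖x - x0‖ → ‖x - x0‖ ≤ R * V x := by
  have hcoer : ∃ R : ℝ, 1 ≤ R ∧ ∀ x, R ≤ ‖x - x0‖ → 1 ≤ V x := by
    obtain ⟨r, hr, hball⟩ : ∃ r > 0, ∀ z, dist z x0 < r → V z < 1 := by
      have := Metric.continuousAt_iff.1 (hV.continuousAt (x := x0)) 1 one_pos
      obtain ⟨r, hr, h⟩ := this
      refine ⟨r, hr, fun z hz => ?_⟩
      have := h hz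
      rw [hx0, Real.dist_eq, sub_zero] at this
      exact (abs_lt.1 this).2
    have htail : Tendsto (fun n : ℕ => ∫ x in (closedBall x0 (n:ℝ))ᶜ, exp (-V x)) atTop (𝓝 0) := by
      have h := tendsto_setIntegral_of_antitone (μ := volume) (f := fun x => exp (-V x))
        (s := fun n : ℕ => (closedBall x0 (n:ℝ))ᶜ) (fun n => measurableSet_closedBall.compl)
        (fun m n hmn => by
          apply compl_subset_compl.2
          exact closedBall_subset_closedBall (by exact_mod_cast hmn)) ⟨0, hZ.integrableOn⟩
      have he : (⋂ n : ℕ, (closedBall x0 (n:ℝ))ᶜ) = ∅ := by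
        rw [← compl_iUnion, iUnion_closedBall_nat, compl_univ]
      simpa [he] using h
    set v := volume.real (ball x0 (r/2)) with hv
    have hvpos : 0 < v := by
      rw [hv, measureReal_def]
      exact ENNReal.toReal_pos (measure_ball_pos _ _ (by linarith)).ne' measure_ball_lt_top.ne
    have hev := htail.eventually (gt_mem_nhds (show (0:ℝ) < exp (-1) * v by positivity))
    obtain ⟨n, hn⟩ := hev.exists
    refine ⟨2 * n + r + 1, by nlinarith [n.cast_nonneg (α := ℝ)], fun x hx => ?_⟩
    by_contra! hlt
    set c : Euc d := (1/2:ℝ) • x0 + (1/2:ℝ) • x with hc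
    have hsub : ball c (r/2) ⊆ (closedBall x0 (n:ℝ))ᶜ := by
      intro y hy
      simp only [mem_compl_iff, mem_closedBall, not_le]
      have h1 : dist c x0 = ‖x - x0‖ / 2 := by
        rw [dist_eq_norm, show c - x0 = (1/2:ℝ) • (x - x0) by rw [hc]; module, norm_smul]
        norm_num; ring
      have := dist_triangle_left c x0 y
      rw [mem_ball] at hy
      linarith
    have hle : ∀ y ∈ ball c (r/2), exp (-1) ≤ exp (-V y) := by
      intro y hy
      apply exp_le_exp.2
      have hz : V ((2:ℝ) • y - x) < 1 := by
        apply hball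
        rw [dist_eq_norm, show (2:ℝ) • y - x - x0 = (2:ℝ) • (y - c) by rw [hc]; module, norm_smul]
        rw [mem_ball, dist_eq_norm] at hy
        norm_num; linarith
      have := hconv.2 (mem_univ ((2:ℝ) • y - x)) (mem_univ x) (show (0:ℝ) ≤ 1/2 by norm_num)
        (show (0:ℝ) ≤ 1/2 by norm_num) (by norm_num)
      rw [show (1/2:ℝ) • ((2:ℝ) • y - x) + (1/2:ℝ) • x = y by module] at this
      simp only [smul_eq_mul] at this
      linarith
    have h1 : exp (-1) * v ≤ ∫ y in ball c (r/2), exp (-V y) := by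
      have := setIntegral_mono_on (μ := volume) (s := ball c (r/2)) (f := fun _ => exp (-1))
        (g := fun y => exp (-V y)) (integrableOn_const measure_ball_lt_top.ne) hZ.integrableOn
        measurableSet_ball hle
      rw [setIntegral_const, smul_eq_mul] at this
      rw [hv, measureReal_def, Measure.addHaar_ball_center, ← Measure.addHaar_ball_center _ c,
        ← measureReal_def]
      linarith
    have h2 : ∫ y in ball c (r/2), exp (-V y) ≤ ∫ y in (closedBall x0 (n:ℝ))ᶜ, exp (-V y) :=
      setIntegral_mono_set hZ.integrableOn (ae_of_all _ fun _ => (exp_pos _).le)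
        hsub.eventuallyLE
    linarith
  obtain ⟨R, hR, h⟩ := hcoer
  refine ⟨R, hR, fun x hx => ?_⟩
  have hp : 0 < ‖x - x0‖ := by linarith
  have h1 := h (x0 + (R / ‖x - x0‖) • (x - x0)) (by
    rw [add_sub_cancel_left, norm_smul, Real.norm_of_nonneg (by positivity)]
    field_simp; exact le_rfl)
  have hs : R / ‖x - x0‖ ≤ 1 := (div_le_one hp).2 hx
  have := hconv.2 (mem_univ x0) (mem_univ x) (show 0 ≤ 1 - R / ‖x - x0‖ by linarith)
    (show 0 ≤ R / ‖x - x0‖ by positivity) (by ring)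
  rw [show (1 - R / ‖x - x0‖) • x0 + (R / ‖x - x0‖) • x = x0 + (R / ‖x - x0‖) • (x - x0) by module,
    hx0] at this
  simp only [smul_eq_mul, mul_zero, zero_add] at this
  have h2 : 1 ≤ R / ‖x - x0‖ * V x := h1.trans this
  rw [div_mul_eq_mul_div, le_div_iff₀ hp] at h2
  linarith

lemma aux_affine {d : ℕ} (x0 x : Euc d) (R : ℝ) (s : ℝ) (hs : 1/2 ≤ s) (hs1 : s ≤ 1)
    (hx : x ∈ closedBall x0 R) (φ : Euc d → ℝ≥0∞) (hφ : Measurable φ) :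
    ∫⁻ y in closedBall x0 R, φ (x + s • (y - x)) ≤ 2 ^ d * ∫⁻ y in closedBall x0 R, φ y := by
  set B := closedBall x0 R with hB
  have hs0 : 0 < s := by linarith
  set ψ : Euc d → ℝ≥0∞ := B.indicator φ with hψ
  have hψm : Measurable ψ := hφ.indicator measurableSet_closedBall
  have h1 : ∫⁻ y in B, φ (x + s • (y - x)) ≤ ∫⁻ y, ψ ((x - s • x) + s • y) := by
    rw [← lintegral_indicator measurableSet_closedBall]
    refine lintegral_mono fun y => ?_
    by_cases hy : y ∈ B
    · have hmem : x + s • (y - x) ∈ B :=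
        (convex_closedBall x0 R).add_smul_sub_mem hx hy ⟨hs0.le, hs1⟩
      rw [indicator_of_mem hy, show (x - s • x) + s • y = x + s • (y - x) by module, hψ,
        indicator_of_mem hmem]
    · rw [indicator_of_notMem hy]; exact zero_le
  have h2 : ∫⁻ y, ψ ((x - s • x) + s • y) = ENNReal.ofReal |(s ^ d)⁻¹| * ∫⁻ y, ψ y := by
    have hm : Measurable fun z => ψ ((x - s • x) + z) := hψm.comp (measurable_const_add _)
    have := lintegral_map (μ := (volume : Measure (Euc d))) (f := fun z => ψ ((x - s • x) + z))
      hm (measurable_const_smul s)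
    rw [Measure.map_addHaar_smul _ hs0.ne', lintegral_smul_measure,
      lintegral_add_left_eq_self ψ] at this
    rw [← this]
    simp
  have h3 : ∫⁻ y, ψ y = ∫⁻ y in B, φ y := lintegral_indicator measurableSet_closedBall _
  rw [h2, h3] at h1
  refine h1.trans ?_
  gcongr
  have : |(s ^ d)⁻¹| ≤ 2 ^ d := by
    rw [abs_of_pos (by positivity), ← inv_pow]
    gcongr
    rw [inv_le_comm₀ hs0 (by norm_num)]; linarith
  calc ENNReal.ofReal |(s ^ d)⁻¹| ≤ ENNReal.ofReal (2 ^ d) := ENNReal.ofReal_le_ofReal this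
    _ = 2 ^ d := by rw [ENNReal.ofReal_pow (by norm_num)]; norm_num

lemma aux_pair {d : ℕ} (U : Euc d → ℝ) (hU : Continuous U) (hconv : ConvexOn ℝ univ U)
    (hU0 : ∀ x, 0 ≤ U x) (x0 : Euc d) (hx0 : U x0 = 0) (R : ℝ) (hR : 0 ≤ R)
    (s : ℝ) (hs : 1/2 ≤ s) (hs1 : s ≤ 1) (g : Euc d → ℝ≥0∞) (hg : Measurable g) :
    ∫⁻ x in closedBall x0 R, ∫⁻ y in closedBall x0 R,
      g (x + s • (y - x)) * (ENNReal.ofReal (exp (-U x)) * ENNReal.ofReal (exp (-U y)))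
    ≤ 4 ^ d * (∫⁻ x in closedBall x0 R, ENNReal.ofReal (exp (-U x))) *
      ∫⁻ x in closedBall x0 R, g x * ENNReal.ofReal (exp (-U x)) := by
  have hwm : Measurable fun x => ENNReal.ofReal (exp (-U x)) := by fun_prop
  have hgw : Measurable fun x => g x * ENNReal.ofReal (exp (-U x)) := hg.mul hwm
  set A := ∫⁻ x in closedBall x0 R, g x * ENNReal.ofReal (exp (-U x)) with hA
  have hin : ∀ x ∈ closedBall x0 R, ∫⁻ y in closedBall x0 R,
      g (x + s • (y - x)) * (ENNReal.ofReal (exp (-U x)) * ENNReal.ofReal (exp (-U y)))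
      ≤ ENNReal.ofReal (exp (-U (x0 + (1/2:ℝ) • (x - x0)))) * (2 ^ d * A) := by
    intro x hx
    refine le_trans ?_ (mul_le_mul_right (aux_affine x0 x R s hs hs1 hx _ hgw) (ENNReal.ofReal (exp (-U (x0 + (1/2:ℝ) • (x - x0))))))
    rw [← lintegral_const_mul _ (by fun_prop)]
    refine lintegral_mono fun y => ?_
    show _ ≤ ENNReal.ofReal (exp (-U (x0 + (1/2:ℝ) • (x - x0)))) *
      (g (x + s • (y - x)) * ENNReal.ofReal (exp (-U (x + s • (y - x)))))
    rw [mul_left_comm (ENNReal.ofReal (exp (-U (x0 + (1/2:ℝ) • (x - x0)))))]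
    refine mul_le_mul_right ?_ (g (x + s • (y - x)))
    rw [← ENNReal.ofReal_mul (exp_pos _).le, ← ENNReal.ofReal_mul (exp_pos _).le,
      ← exp_add, ← exp_add]
    refine ENNReal.ofReal_le_ofReal (exp_le_exp.2 ?_)
    have h1 := hconv.2 (mem_univ x) (mem_univ y) (show 0 ≤ 1 - s by linarith)
      (show 0 ≤ s by linarith) (by ring)
    have h2 := hconv.2 (mem_univ x0) (mem_univ x) (show (0:ℝ) ≤ 1/2 by norm_num)
      (show (0:ℝ) ≤ 1/2 by norm_num) (by norm_num)
    rw [show (1 - s) • x + s • y = x + s • (y - x) by module] at h1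
    rw [show (1/2:ℝ) • x0 + (1/2:ℝ) • x = x0 + (1/2:ℝ) • (x - x0) by module] at h2
    simp only [smul_eq_mul, hx0] at h1 h2
    nlinarith [hU0 x, hU0 y, mul_nonneg (show 0 ≤ s - 1/2 by linarith) (hU0 x),
      mul_nonneg (show 0 ≤ 1 - s by linarith) (hU0 y)]
  refine (setLIntegral_mono' measurableSet_closedBall hin).trans ?_
  rw [lintegral_mul_const _ (by fun_prop)]
  have h3 := aux_affine x0 x0 R (1/2) le_rfl (by norm_num) (mem_closedBall_self hR) _ hwm
  refine (mul_le_mul_left h3 _).trans (le_of_eq ?_)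
  rw [show (4:ℝ≥0∞) ^ d = 2 ^ d * 2 ^ d by rw [← mul_pow]; norm_num]
  ring

lemma aux_segment {d : ℕ} (f : Euc d → ℝ) (hf : ContDiff ℝ 1 f) (x y : Euc d) (D : ℝ)
    (hD : ‖y - x‖ ^ 2 ≤ D) :
    ENNReal.ofReal ((f x - f y) ^ 2) ≤
      ENNReal.ofReal D * ∫⁻ t in Icc (0:ℝ) 1, ENNReal.ofReal (‖fderiv ℝ f (x + t • (y - x))‖ ^ 2) := by
  have hc : Continuous (fderiv ℝ f) := hf.continuous_fderiv (by norm_num)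
  have hcl : Continuous fun t : ℝ => fderiv ℝ f (x + t • (y - x)) := by fun_prop
  set h : ℝ → ℝ := fun t => fderiv ℝ f (x + t • (y - x)) (y - x) with hh
  have hhc : Continuous h := by fun_prop
  have hder : ∀ t ∈ uIcc (0:ℝ) 1, HasDerivAt (fun t : ℝ => f (x + t • (y - x))) (h t) t := by
    intro t _
    have h1 : HasDerivAt (fun t : ℝ => x + t • (y - x)) (y - x) t := by
      simpa using ((hasDerivAt_id t).smul_const (y - x)).const_add x
    exact ((hf.differentiable (by norm_num)) _).hasFDerivAt.comp_hasDerivAt t h1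
  have hint := intervalIntegral.integral_eq_sub_of_hasDerivAt hder (hhc.intervalIntegrable 0 1)
  simp only [one_smul, zero_smul, add_zero, add_sub_cancel] at hint
  set c := f y - f x with hcdef
  have hsq : c ^ 2 ≤ ∫ t in (0:ℝ)..1, h t ^ 2 := by
    have h0 : 0 ≤ ∫ t in (0:ℝ)..1, (h t - c) ^ 2 :=
      intervalIntegral.integral_nonneg (by norm_num) fun _ _ => sq_nonneg _
    have h1 : ∫ t in (0:ℝ)..1, (h t - c) ^ 2 = (∫ t in (0:ℝ)..1, h t ^ 2) - 2 * c * c + c ^ 2 := by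
      have : ∀ t, (h t - c) ^ 2 = h t ^ 2 - 2 * c * h t + c ^ 2 := fun t => by ring
      simp_rw [this]
      rw [intervalIntegral.integral_add, intervalIntegral.integral_sub,
        intervalIntegral.integral_const_mul, hint]
      · simp
      all_goals exact Continuous.intervalIntegrable (by fun_prop) _ _
    nlinarith
  have hle : ∫ t in (0:ℝ)..1, h t ^ 2 ≤
      ∫ t in (0:ℝ)..1, D * ‖fderiv ℝ f (x + t • (y - x))‖ ^ 2 := by
    refine intervalIntegral.integral_mono_on (by norm_num)
      (Continuous.intervalIntegrable (by fun_prop) _ _)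
      (Continuous.intervalIntegrable (by fun_prop) _ _) fun t _ => ?_
    have := (fderiv ℝ f (x + t • (y - x))).le_opNorm (y - x)
    calc h t ^ 2 = ‖h t‖ ^ 2 := by simp
      _ ≤ (‖fderiv ℝ f (x + t • (y - x))‖ * ‖y - x‖) ^ 2 := by gcongr
      _ = ‖y - x‖ ^ 2 * ‖fderiv ℝ f (x + t • (y - x))‖ ^ 2 := by ring
      _ ≤ _ := by gcongr
  have hD0 : 0 ≤ D := (sq_nonneg _).trans hD
  rw [intervalIntegral.integral_const_mul] at hle
  have e : ENNReal.ofReal (∫ t in (0:ℝ)..1, ‖fderiv ℝ f (x + t • (y - x))‖ ^ 2) =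
      ∫⁻ t in Icc (0:ℝ) 1, ENNReal.ofReal (‖fderiv ℝ f (x + t • (y - x))‖ ^ 2) := by
    rw [intervalIntegral.integral_of_le (by norm_num), ← integral_Icc_eq_integral_Ioc,
      ofReal_integral_eq_lintegral_ofReal]
    · exact Continuous.integrableOn_Icc (by fun_prop)
    · exact ae_of_all _ fun _ => by positivity
  rw [← e, ← ENNReal.ofReal_mul hD0]
  refine ENNReal.ofReal_le_ofReal ?_
  nlinarith

lemma aux_ball {d : ℕ} (U : Euc d → ℝ) (hU : Continuous U) (hconv : ConvexOn ℝ univ U)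
    (hU0 : ∀ x, 0 ≤ U x) (x0 : Euc d) (hx0 : U x0 = 0) (R : ℝ) (hR : 0 < R)
    (f : Euc d → ℝ) (hf : ContDiff ℝ 1 f) :
    ∃ m : ℝ, ∫⁻ x in closedBall x0 R, ENNReal.ofReal ((f x - m) ^ 2) * ENNReal.ofReal (exp (-U x))
      ≤ ENNReal.ofReal (4 * R ^ 2) * 4 ^ d *
      ∫⁻ x in closedBall x0 R, ENNReal.ofReal (‖fderiv ℝ f x‖ ^ 2) * ENNReal.ofReal (exp (-U x)) := by
  have hc : Continuous (fderiv ℝ f) := hf.continuous_fderiv (by norm_num)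
  have hfc : Continuous f := hf.continuous
  set B := closedBall x0 R with hB
  set w : Euc d → ℝ≥0∞ := fun x => ENNReal.ofReal (exp (-U x)) with hw
  have hwc : Continuous w := ENNReal.continuous_ofReal.comp (by fun_prop)
  have hwm : Measurable w := hwc.measurable
  set g : Euc d → ℝ≥0∞ := fun x => ENNReal.ofReal (‖fderiv ℝ f x‖ ^ 2) with hg
  have hgc : Continuous g := ENNReal.continuous_ofReal.comp (by fun_prop)
  have hgm : Measurable g := hgc.measurable
  set Z := ∫⁻ x in B, w x with hZ
  set A := ∫⁻ x in B, g x * w x with hA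
  have hZtop : Z ≠ ∞ := by
    have : Z ≤ ∫⁻ x in B, 1 := by
      refine lintegral_mono fun x => ?_
      simp only [hw]
      rw [← ENNReal.ofReal_one]
      exact ENNReal.ofReal_le_ofReal (by simpa using hU0 x)
    refine ne_top_of_le_ne_top ?_ this
    simpa using (isCompact_closedBall x0 R).measure_lt_top.ne
  have hZ0 : Z ≠ 0 := by
    rw [hZ, Ne, lintegral_eq_zero_iff hwm]
    intro h
    have h1 : volume.restrict B = 0 := by
      rw [← Measure.measure_univ_eq_zero, ← nonpos_iff_eq_zero]
      refine le_of_eq ?_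
      have := ae_iff.1 h
      refine le_antisymm ((measure_mono ?_).trans this.le) zero_le
      intro x _
      simp [hw, exp_pos]
    rw [Measure.restrict_eq_zero] at h1
    exact (measure_closedBall_pos volume x0 hR).ne' h1
  -- pairs
  have hI : ∀ t ∈ Icc (0:ℝ) 1, ∫⁻ y in B, ∫⁻ x in B, g (x + t • (y - x)) * (w x * w y)
      ≤ 4 ^ d * Z * A := by
    intro t ht
    by_cases h : 1/2 ≤ t
    · rw [lintegral_lintegral_swap]
      · exact aux_pair U hU hconv hU0 x0 hx0 R hR.le t h ht.2 g hgm
      · apply Measurable.aemeasurable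
        show Measurable fun p : Euc d × Euc d => g (p.2 + t • (p.1 - p.2)) * (w p.2 * w p.1)
        apply Measurable.fun_mul
        · exact (hgc.comp (by fun_prop)).measurable
        · exact (hwm.comp measurable_snd).mul (hwm.comp measurable_fst)
    · have := aux_pair U hU hconv hU0 x0 hx0 R hR.le (1 - t) (by linarith) (by linarith [ht.1]) g hgm
      refine le_trans (le_of_eq ?_) this
      refine lintegral_congr fun y => lintegral_congr fun x => ?_
      rw [show y + (1 - t) • (x - y) = x + t • (y - x) by module, mul_comm (w x)]
  have hmeas3 : Measurable fun p : (Euc d × Euc d) × ℝ =>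
      g (p.1.1 + p.2 • (p.1.2 - p.1.1)) * (w p.1.1 * w p.1.2) := by
    apply Measurable.fun_mul
    · exact (hgc.comp (by fun_prop)).measurable
    · exact (hwm.comp (by fun_prop)).mul (hwm.comp (by fun_prop))
  have hJ : ∫⁻ y in B, ∫⁻ x in B, ENNReal.ofReal ((f x - f y) ^ 2) * (w x * w y) ≤
      ENNReal.ofReal (4 * R ^ 2) * (4 ^ d * Z * A) := by
    calc ∫⁻ y in B, ∫⁻ x in B, ENNReal.ofReal ((f x - f y) ^ 2) * (w x * w y)
        ≤ ∫⁻ y in B, ∫⁻ x in B, ENNReal.ofReal (4 * R ^ 2) *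
            ∫⁻ t in Icc (0:ℝ) 1, g (x + t • (y - x)) * (w x * w y) := by
          refine setLIntegral_mono' measurableSet_closedBall fun y hy =>
            setLIntegral_mono' measurableSet_closedBall fun x hx => ?_
          rw [lintegral_mul_const _ (show Measurable fun t : ℝ => g (x + t • (y - x)) from (hgc.comp (by fun_prop)).measurable), ← mul_assoc (ENNReal.ofReal (4 * R ^ 2))]
          refine mul_le_mul_left ?_ (w x * w y)
          refine aux_segment f hf x y _ ?_
          have : ‖y - x‖ ≤ 2 * R := by
            rw [← dist_eq_norm]
            have := dist_triangle_right y x x0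
            rw [hB, mem_closedBall] at hx hy
            linarith
          nlinarith [norm_nonneg (y - x)]
      _ = ENNReal.ofReal (4 * R ^ 2) * ∫⁻ y in B, ∫⁻ x in B,
            ∫⁻ t in Icc (0:ℝ) 1, g (x + t • (y - x)) * (w x * w y) := by
          rw [← lintegral_const_mul' _ _ ENNReal.ofReal_ne_top]
          refine lintegral_congr fun y => ?_
          rw [lintegral_const_mul' _ _ ENNReal.ofReal_ne_top]
      _ = ENNReal.ofReal (4 * R ^ 2) * ∫⁻ t in Icc (0:ℝ) 1, ∫⁻ y in B, ∫⁻ x in B,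
            g (x + t • (y - x)) * (w x * w y) := by
          congr 1
          have e1 : ∀ y, ∫⁻ x in B, ∫⁻ t in Icc (0:ℝ) 1, g (x + t • (y - x)) * (w x * w y) =
              ∫⁻ t in Icc (0:ℝ) 1, ∫⁻ x in B, g (x + t • (y - x)) * (w x * w y) := by
            intro y
            refine lintegral_lintegral_swap (Measurable.aemeasurable ?_)
            exact hmeas3.comp (f := fun q : Euc d × ℝ => ((q.1, y), q.2)) (by fun_prop)
          simp_rw [e1]
          refine lintegral_lintegral_swap (Measurable.aemeasurable ?_)
          refine Measurable.lintegral_prod_right'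
            (f := fun q : (Euc d × ℝ) × Euc d => g (q.2 + q.1.2 • (q.1.1 - q.2)) * (w q.2 * w q.1.1)) ?_
          exact hmeas3.comp (f := fun q : (Euc d × ℝ) × Euc d => ((q.2, q.1.1), q.1.2)) (by fun_prop)
      _ ≤ ENNReal.ofReal (4 * R ^ 2) * ∫⁻ t in Icc (0:ℝ) 1, 4 ^ d * Z * A := by
          refine mul_le_mul_right ?_ _
          exact setLIntegral_mono' measurableSet_Icc hI
      _ = _ := by simp
  by_contra! hcon
  set K := ENNReal.ofReal (4 * R ^ 2) * 4 ^ d * A with hK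
  have hG : ∀ y, K < ∫⁻ x in B, ENNReal.ofReal ((f x - f y) ^ 2) * w x := fun y => hcon (f y)
  have hGm : Measurable fun y => ∫⁻ x in B, ENNReal.ofReal ((f x - f y) ^ 2) * w x := by
    refine Measurable.lintegral_prod_right'
      (f := fun q : Euc d × Euc d => ENNReal.ofReal ((f q.2 - f q.1) ^ 2) * w q.2) ?_
    apply Measurable.fun_mul
    · exact (ENNReal.continuous_ofReal.comp (by fun_prop)).measurable
    · exact hwm.comp (by fun_prop)
  have : IsFiniteMeasure ((volume.restrict B).withDensity w) := isFiniteMeasure_withDensity hZtop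
  obtain ⟨y, hy⟩ := exists_le_laverage (μ := (volume.restrict B).withDensity w)
    (f := fun y => ∫⁻ x in B, ENNReal.ofReal ((f x - f y) ^ 2) * w x) (by
      intro h0
      apply hZ0
      have : (volume.restrict B).withDensity w univ = 0 := by rw [h0]; simp
      rwa [withDensity_apply _ MeasurableSet.univ, setLIntegral_univ] at this) hGm.aemeasurable
  have hlt := (hG y).trans_le hy
  rw [laverage_eq, withDensity_apply _ MeasurableSet.univ, setLIntegral_univ,
    lintegral_withDensity_eq_lintegral_mul _ hwm hGm] at hlt
  have e2 : ∫⁻ a in B, (w * fun y => ∫⁻ x in B, ENNReal.ofReal ((f x - f y) ^ 2) * w x) a =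
      ∫⁻ y in B, ∫⁻ x in B, ENNReal.ofReal ((f x - f y) ^ 2) * (w x * w y) := by
    refine lintegral_congr fun y => ?_
    simp only [Pi.mul_apply]
    rw [← lintegral_const_mul' _ _ ENNReal.ofReal_ne_top]
    refine lintegral_congr fun x => ?_
    ring
  rw [e2] at hlt
  have : (∫⁻ y in B, ∫⁻ x in B, ENNReal.ofReal ((f x - f y) ^ 2) * (w x * w y)) / Z ≤ K := by
    rw [ENNReal.div_le_iff hZ0 hZtop]
    refine hJ.trans (le_of_eq ?_)
    rw [hK]; ring
  exact absurd hlt (not_lt.2 this)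

lemma aux_ibp {d : ℕ} (x0 : Euc d) (H : Euc d → ℝ) (hH : ContDiff ℝ 1 H)
    (hs : HasCompactSupport H) (hpos : ∀ x, 0 ≤ H x) :
    -(∫ x, fderiv ℝ H x ((√(1 + ‖x - x0‖ ^ 2))⁻¹ • (x - x0))) ≤ d * ∫ x, H x := by
  set q : Euc d → ℝ := fun x => (√(1 + ‖x - x0‖ ^ 2))⁻¹ with hq
  have hqpos : ∀ x, 0 < q x := fun x => by simp only [hq]; positivity
  have hq1 : ∀ x, q x ≤ 1 := fun x => by
    simp only [hq]
    apply inv_le_one_of_one_le₀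
    rw [Real.one_le_sqrt]; nlinarith [sq_nonneg ‖x - x0‖]
  have hqC : ContDiff ℝ 1 q := by
    apply ContDiff.inv
    · apply ContDiff.sqrt
      · exact contDiff_const.add ((contDiff_id.sub contDiff_const).norm_sq ℝ)
      · intro x; positivity
    · intro x; positivity
  let e : Fin d → Euc d := fun i => EuclideanSpace.single i 1
  let F : Fin d → Euc d → ℝ := fun i x => q x * (x - x0) i
  have hcoord : ∀ i, ContDiff ℝ 1 (fun x : Euc d => (x - x0) i) := fun i =>
    (EuclideanSpace.proj (𝕜 := ℝ) i).contDiff.comp (contDiff_id.sub contDiff_const)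
  have hFC : ∀ i, ContDiff ℝ 1 (F i) := fun i => hqC.mul (hcoord i)
  have hdF : ∀ i x, fderiv ℝ (F i) x (e i) ≤ 1 := by
    intro i x
    have hN : HasFDerivAt (fun x : Euc d => 1 + ‖x - x0‖ ^ 2) (2 • (innerSL ℝ (x - x0))) x := by
      have := ((hasFDerivAt_id (𝕜 := ℝ) x).sub_const x0).norm_sq
      simpa using this.const_add 1
    have hS : (1 + ‖x - x0‖ ^ 2) ≠ 0 := by positivity
    have hsq := hN.sqrt hS
    have hi := (hasDerivAt_inv (by positivity : √(1 + ‖x - x0‖ ^ 2) ≠ 0)).comp_hasFDerivAt x hsq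
    have hp : HasFDerivAt (fun x : Euc d => (x - x0) i) (EuclideanSpace.proj (𝕜 := ℝ) i : Euc d →L[ℝ] ℝ) x :=
      (EuclideanSpace.proj (𝕜 := ℝ) i : Euc d →L[ℝ] ℝ).hasFDerivAt.comp x
        ((hasFDerivAt_id (𝕜 := ℝ) x).sub_const x0)
    have hF := hi.mul hp
    have hF' : fderiv ℝ (F i) x = _ := hF.fderiv
    rw [hF']
    simp [e, EuclideanSpace.inner_single_right]
    have h1 := hq1 x
    simp only [hq] at h1
    have h2 : 0 ≤ (x.ofLp i - x0.ofLp i) ^ 2 * ((√(1 + ‖x - x0‖ ^ 2) ^ 2)⁻¹ *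
      (√(1 + ‖x - x0‖ ^ 2))⁻¹) := by positivity
    nlinarith
  have hHc := hH.continuous
  have hH'c : Continuous (fderiv ℝ H) := hH.continuous_fderiv (by norm_num)
  have hH's : HasCompactSupport (fderiv ℝ H) := hs.fderiv ℝ
  have hHint : Integrable H := hHc.integrable_of_hasCompactSupport hs
  have hi1 : ∀ i, Integrable fun x => fderiv ℝ H x (e i) * F i x := fun i => by
    have := (hFC i).continuous
    apply Continuous.integrable_of_hasCompactSupport (by fun_prop)
    apply HasCompactSupport.mul_right
    exact hs.fderiv_apply ℝ (e i)
  have hi2 : ∀ i, Integrable fun x => H x * fderiv ℝ (F i) x (e i) := fun i => by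
    have : Continuous (fderiv ℝ (F i)) := (hFC i).continuous_fderiv (by norm_num)
    exact Continuous.integrable_of_hasCompactSupport (by fun_prop) hs.mul_right
  have hi3 : ∀ i, Integrable fun x => H x * F i x := fun i => by
    have := (hFC i).continuous
    exact Continuous.integrable_of_hasCompactSupport (by fun_prop) hs.mul_right
  have hibp : ∀ i, ∫ x, H x * fderiv ℝ (F i) x (e i) = - ∫ x, fderiv ℝ H x (e i) * F i x := fun i =>
    integral_mul_fderiv_eq_neg_fderiv_mul_of_integrable (hi1 i) (hi2 i) (hi3 i)
      (fun x _ => hH.differentiable (by norm_num) x)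
      (fun x _ => (hFC i).differentiable (by norm_num) x)
  have hsum : ∀ x, fderiv ℝ H x (q x • (x - x0)) = ∑ i, fderiv ℝ H x (e i) * F i x := by
    intro x
    have : q x • (x - x0) = ∑ i, F i x • e i := by
      have := (EuclideanSpace.basisFun (Fin d) ℝ).sum_repr (q x • (x - x0))
      rw [← this]
      refine Finset.sum_congr rfl fun i _ => ?_
      simp [F, e]
    rw [this, map_sum]
    refine Finset.sum_congr rfl fun i _ => ?_
    rw [map_smul, smul_eq_mul, mul_comm]
  rw [show (∫ x, fderiv ℝ H x ((√(1 + ‖x - x0‖ ^ 2))⁻¹ • (x - x0))) =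
    ∫ x, ∑ i, fderiv ℝ H x (e i) * F i x from integral_congr_ae (ae_of_all _ hsum)]
  rw [integral_finsetSum _ fun i _ => hi1 i, ← Finset.sum_neg_distrib]
  rw [Finset.sum_congr rfl fun i _ => (hibp i).symm]
  calc ∑ i, ∫ x, H x * fderiv ℝ (F i) x (e i) ≤ ∑ i : Fin d, ∫ x, H x := by
        refine Finset.sum_le_sum fun i _ => integral_mono (hi2 i) hHint fun x => ?_
        exact mul_le_of_le_one_right (hpos x) (hdF i x)
    _ = d * ∫ x, H x := by simp

lemma aux_lyap {d : ℕ} (U : Euc d → ℝ) (hU : ContDiff ℝ 1 U) (hconv : ConvexOn ℝ univ U)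
    (hU0 : ∀ x, 0 ≤ U x) (x0 : Euc d) (hx0 : U x0 = 0) (R : ℝ) (hR : 1 ≤ R)
    (hgrow : ∀ x, R ≤ ‖x - x0‖ → 2 * (d + 1) * ‖x - x0‖ ≤ U x)
    (g : Euc d → ℝ) (hg : ContDiff ℝ 1 g)
    (hi1 : Integrable fun x => g x ^ 2 * exp (-U x))
    (hi2 : Integrable fun x => ‖fderiv ℝ g x‖ ^ 2 * exp (-U x)) :
    ∫ x, g x ^ 2 * exp (-U x) ≤ 2 * (d + 1) * (∫ x in closedBall x0 R, g x ^ 2 * exp (-U x))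
      + 4 * ∫ x, ‖fderiv ℝ g x‖ ^ 2 * exp (-U x) := by
  set B := closedBall x0 R with hB
  set k : Euc d → ℝ := fun x => (1/2) * (g x ^ 2 * exp (-U x)) - 2 * (‖fderiv ℝ g x‖ ^ 2 * exp (-U x))
    - (d + 1) * B.indicator (fun x => g x ^ 2 * exp (-U x)) x with hk
  have hi3 : Integrable (B.indicator (fun x => g x ^ 2 * exp (-U x))) :=
    hi1.indicator measurableSet_closedBall
  have hkint : Integrable k := ((hi1.const_mul _).sub (hi2.const_mul _)).sub (hi3.const_mul _)
  have hUpos : ∀ x, U x ≤ fderiv ℝ U x (x - x0) := by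
    intro x
    have hd : HasDerivAt (fun t : ℝ => U (x + t • (x0 - x))) (fderiv ℝ U x (x0 - x)) 0 := by
      have h1 : HasDerivAt (fun t : ℝ => x + t • (x0 - x)) (x0 - x) 0 := by
        simpa using ((hasDerivAt_id (0:ℝ)).smul_const (x0 - x)).const_add x
      have h2 : HasFDerivAt U (fderiv ℝ U x) (x + (0:ℝ) • (x0 - x)) := by
        simpa using (hU.differentiable (by norm_num) x).hasFDerivAt
      exact h2.comp_hasDerivAt 0 h1
    have hcv : ConvexOn ℝ univ (fun t : ℝ => U (x + t • (x0 - x))) := by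
      refine ⟨convex_univ, fun s _ t _ a b ha hb hab => ?_⟩
      have := hconv.2 (mem_univ (x + s • (x0 - x))) (mem_univ (x + t • (x0 - x))) ha hb hab
      have e : a • (x + s • (x0 - x)) + b • (x + t • (x0 - x)) =
          x + (a • s + b • t) • (x0 - x) := by
        calc _ = (a + b) • x + (a • s + b • t) • (x0 - x) := by simp only [smul_eq_mul]; module
          _ = _ := by rw [hab, one_smul]
      rw [e] at this
      exact this
    have := hcv.le_slope_of_hasDerivAt (mem_univ 0) (mem_univ 1) one_pos hd
    simp [slope_def_field, hx0] at this
    have e : fderiv ℝ U x (x - x0) = - fderiv ℝ U x (x0 - x) := by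
      rw [← map_neg, neg_sub]
    simp only [map_sub] at *
    linarith
  set F : Euc d → Euc d := fun x => (√(1 + ‖x - x0‖ ^ 2))⁻¹ • (x - x0) with hF
  have hF1 : ∀ x, ‖F x‖ ≤ 1 := by
    intro x
    simp only [hF]
    rw [norm_smul, Real.norm_of_nonneg (by positivity), inv_mul_le_iff₀ (by positivity), mul_one]
    exact Real.le_sqrt_of_sq_le (by linarith)
  have hUF0 : ∀ x, 0 ≤ fderiv ℝ U x (F x) := fun x => by
    simp only [hF, map_smul, smul_eq_mul]
    exact mul_nonneg (by positivity) ((hU0 x).trans (hUpos x))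
  have hUF : ∀ x, x ∉ B → (d:ℝ) + 1 ≤ fderiv ℝ U x (F x) := fun x hx => by
    simp only [hF, map_smul, smul_eq_mul]
    rw [hB, mem_closedBall, dist_eq_norm, not_le] at hx
    have h1 := (hgrow x hx.le).trans (hUpos x)
    rw [inv_mul_eq_div, le_div_iff₀ (by positivity)]
    have h2 : √(1 + ‖x - x0‖ ^ 2) ≤ 2 * ‖x - x0‖ := by
      rw [Real.sqrt_le_left (by positivity)]
      nlinarith
    have h3 : ((d:ℝ) + 1) * √(1 + ‖x - x0‖ ^ 2) ≤ (d + 1) * (2 * ‖x - x0‖) := by gcongr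
    linarith
  set χ : ℕ → Euc d → ℝ := fun n x => smoothTransition (2 - ‖x - x0‖ ^ 2 / (n + 1)) with hχ
  have hst : ContDiff ℝ 1 smoothTransition := Real.smoothTransition.contDiff
  have hχC : ∀ n, ContDiff ℝ 1 (χ n) := fun n => by
    apply hst.comp
    exact contDiff_const.sub (((contDiff_id.sub contDiff_const).norm_sq ℝ).div_const _)
  have hχs : ∀ n, HasCompactSupport (χ n) := fun n => by
    apply HasCompactSupport.intro (isCompact_closedBall x0 (2 * (n + 1)))
    intro x hx
    rw [mem_closedBall, dist_eq_norm, not_le] at hx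
    apply Real.smoothTransition.zero_of_nonpos
    rw [sub_nonpos, le_div_iff₀ (by positivity)]
    have : (0:ℝ) ≤ n := n.cast_nonneg
    nlinarith
  have hχF : ∀ n x, fderiv ℝ (χ n) x (F x) ≤ 0 := fun n x => by
    have hN : HasFDerivAt (fun x : Euc d => ‖x - x0‖ ^ 2) (2 • (innerSL ℝ (x - x0))) x := by
      have := ((hasFDerivAt_id (𝕜 := ℝ) x).sub_const x0).norm_sq
      simpa using this
    have h1 : HasFDerivAt (fun x : Euc d => 2 - ‖x - x0‖ ^ 2 / ((n:ℝ) + 1))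
        (-(((n:ℝ) + 1)⁻¹ • (2 • (innerSL ℝ (x - x0))))) x := by
      simp only [div_eq_inv_mul]
      exact (hN.const_mul _).const_sub 2
    have h2 := ((hst.differentiable (by norm_num)) (2 - ‖x - x0‖ ^ 2 / ((n:ℝ) + 1))).hasDerivAt.comp_hasFDerivAt x h1
    have h3 : fderiv ℝ (χ n) x = _ := h2.fderiv
    rw [h3]
    have h4 : 0 ≤ deriv smoothTransition (2 - ‖x - x0‖ ^ 2 / ((n:ℝ) + 1)) :=
      Real.smoothTransition.monotone.deriv_nonneg
    simp only [smul_apply, neg_apply, smul_eq_mul,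
      innerSL_apply_apply, hF, inner_smul_right, real_inner_self_eq_norm_sq, nsmul_eq_mul]
    refine mul_nonpos_of_nonneg_of_nonpos h4 ?_
    rw [neg_nonpos]; positivity
  have hgc := hg.continuous
  have hg'c : Continuous (fderiv ℝ g) := hg.continuous_fderiv (by norm_num)
  have hUc := hU.continuous
  have hχ0 : ∀ n x, 0 ≤ χ n x := fun n x => Real.smoothTransition.nonneg _
  have hχ1 : ∀ n x, χ n x ≤ 1 := fun n x => Real.smoothTransition.le_one _
  have hmain : ∀ n, ∫ x, χ n x * k x ≤ 0 := by
    intro n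
    set H : Euc d → ℝ := fun x => χ n x * (g x ^ 2 * exp (-U x)) with hH
    have hHC : ContDiff ℝ 1 H := (hχC n).mul ((hg.pow 2).mul hU.neg.exp)
    have hHs : HasCompactSupport H := (hχs n).mul_right
    have hibp := aux_ibp x0 H hHC hHs (fun x => mul_nonneg (hχ0 n x) (by positivity))
    have hHint : Integrable H := hHC.continuous.integrable_of_hasCompactSupport hHs
    have hH'c : Continuous (fderiv ℝ H) := hHC.continuous_fderiv (by norm_num)
    have hFc : Continuous F := by
      have h1 : Continuous fun x : Euc d => (√(1 + ‖x - x0‖ ^ 2))⁻¹ :=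
        Continuous.inv₀ (by fun_prop) fun x => by positivity
      exact h1.smul (by fun_prop)
    have hDint : Integrable fun x => fderiv ℝ H x (F x) := by
      apply Continuous.integrable_of_hasCompactSupport (by fun_prop)
      refine (hHs.fderiv ℝ).mono ?_
      intro x hx
      rw [Function.mem_support] at hx ⊢
      intro h0; apply hx; simp [h0]
    have hpt : ∀ x, χ n x * k x ≤ -fderiv ℝ H x (F x) - d * H x := by
      intro x
      have hd : fderiv ℝ H x (F x) = fderiv ℝ (χ n) x (F x) * (g x ^ 2 * exp (-U x)) +
          χ n x * (2 * g x * fderiv ℝ g x (F x) * exp (-U x)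
            - g x ^ 2 * exp (-U x) * fderiv ℝ U x (F x)) := by
        have a1 := ((hχC n).differentiable (by norm_num) x).hasFDerivAt
        have a2 := (hg.differentiable (by norm_num) x).hasFDerivAt
        have a3 := (hU.differentiable (by norm_num) x).hasFDerivAt
        have := (a1.mul ((a2.pow 2).mul a3.neg.exp)).fderiv
        have h' : fderiv ℝ H x = _ := this
        rw [h']
        simp
        ring
      have hw := exp_pos (-U x)
      have hdg : 2 * g x * fderiv ℝ g x (F x) ≤ (1/2) * g x ^ 2 + 2 * ‖fderiv ℝ g x‖ ^ 2 := by
        have h1 : |fderiv ℝ g x (F x)| ≤ ‖fderiv ℝ g x‖ := by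
          have := (fderiv ℝ g x).le_opNorm (F x)
          rw [Real.norm_eq_abs] at this
          nlinarith [hF1 x, norm_nonneg (fderiv ℝ g x)]
        have h2 : (fderiv ℝ g x (F x)) ^ 2 ≤ ‖fderiv ℝ g x‖ ^ 2 :=
          sq_le_sq' (abs_le.1 h1).1 (abs_le.1 h1).2
        nlinarith [sq_nonneg (g x - 2 * fderiv ℝ g x (F x))]
      have hb : (d:ℝ) + 1 - B.indicator (fun _ => (d:ℝ) + 1) x ≤ fderiv ℝ U x (F x) := by
        by_cases hx : x ∈ B
        · rw [indicator_of_mem hx]; simpa using hUF0 x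
        · rw [indicator_of_notMem hx]; simpa using hUF x hx
      have hind : (d + 1) * B.indicator (fun x => g x ^ 2 * exp (-U x)) x =
          B.indicator (fun _ => (d:ℝ) + 1) x * (g x ^ 2 * exp (-U x)) := by
        by_cases hx : x ∈ B <;> simp [hx]
      rw [hd]
      simp only [hk, hH]
      rw [hind]
      have p1 : 0 ≤ -fderiv ℝ (χ n) x (F x) * (g x ^ 2 * exp (-U x)) :=
        mul_nonneg (by linarith [hχF n x]) (by positivity)
      have p2 := mul_le_mul_of_nonneg_left hdg (mul_nonneg (hχ0 n x) hw.le)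
      have p3 := mul_le_mul_of_nonneg_left hb
        (mul_nonneg (hχ0 n x) (show 0 ≤ g x ^ 2 * exp (-U x) by positivity))
      nlinarith
    have hint2 : Integrable fun x => χ n x * k x := by
      refine hkint.bdd_mul (c := 1) (hχC n).continuous.aestronglyMeasurable (ae_of_all _ fun x => ?_)
      rw [Real.norm_of_nonneg (hχ0 n x)]; exact hχ1 n x
    have := integral_mono hint2 (hDint.neg.sub (hHint.const_mul (d:ℝ))) hpt
    refine this.trans ?_
    have e : ∫ x, ((-fun x => fderiv ℝ H x (F x)) - fun x => (d:ℝ) * H x) x =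
      -(∫ x, fderiv ℝ H x (F x)) - d * ∫ x, H x := by
      rw [integral_sub' hDint.neg (hHint.const_mul _), integral_neg', integral_const_mul]
    rw [e]
    linarith
  have hlim : Tendsto (fun n => ∫ x, χ n x * k x) atTop (𝓝 (∫ x, k x)) := by
    refine tendsto_integral_of_dominated_convergence (fun x => ‖k x‖) ?_ hkint.norm ?_ ?_
    · intro n
      exact (hχC n).continuous.aestronglyMeasurable.mul hkint.aestronglyMeasurable
    · intro n
      refine ae_of_all _ fun x => ?_
      rw [norm_mul, Real.norm_of_nonneg (hχ0 n x)]
      exact mul_le_of_le_one_left (norm_nonneg _) (hχ1 n x)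
    · refine ae_of_all _ fun x => ?_
      apply tendsto_const_nhds.congr'
      filter_upwards [eventually_ge_atTop ⌈‖x - x0‖ ^ 2⌉₊] with n hn
      have : χ n x = 1 := by
        apply Real.smoothTransition.one_of_one_le
        have h1 : ‖x - x0‖ ^ 2 ≤ n := Nat.ceil_le.1 hn
        have : ‖x - x0‖ ^ 2 / ((n:ℝ) + 1) ≤ 1 := by
          rw [div_le_one (by positivity)]; linarith
        linarith
      rw [this, one_mul]
  have hk0 : ∫ x, k x ≤ 0 := le_of_tendsto' hlim hmain
  have hkeq : ∫ x, k x = (1/2) * (∫ x, g x ^ 2 * exp (-U x))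
      - 2 * (∫ x, ‖fderiv ℝ g x‖ ^ 2 * exp (-U x))
      - (d + 1) * ∫ x in B, g x ^ 2 * exp (-U x) := by
    have hi12 : Integrable fun x => (1/2:ℝ) * (g x ^ 2 * exp (-U x))
      - 2 * (‖fderiv ℝ g x‖ ^ 2 * exp (-U x)) := (hi1.const_mul _).sub (hi2.const_mul _)
    simp only [hk]
    rw [integral_sub hi12 (hi3.const_mul _),
      integral_sub (hi1.const_mul _) (hi2.const_mul _), integral_const_mul, integral_const_mul,
      integral_const_mul, integral_indicator measurableSet_closedBall]
  linarith

lemma aux_ball_real {d : ℕ} (U : Euc d → ℝ) (hU : Continuous U) (hconv : ConvexOn ℝ univ U)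
    (hU0 : ∀ x, 0 ≤ U x) (x0 : Euc d) (hx0 : U x0 = 0) (R : ℝ) (hR : 0 < R)
    (f : Euc d → ℝ) (hf : ContDiff ℝ 1 f) :
    ∃ m : ℝ, ∫ x in closedBall x0 R, (f x - m) ^ 2 * exp (-U x) ≤ 4 * R ^ 2 * 4 ^ d *
      ∫ x in closedBall x0 R, ‖fderiv ℝ f x‖ ^ 2 * exp (-U x) := by
  obtain ⟨m, hm⟩ := aux_ball U hU hconv hU0 x0 hx0 R hR f hf
  refine ⟨m, ?_⟩
  have hc : Continuous (fderiv ℝ f) := hf.continuous_fderiv (by norm_num)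
  have hfc : Continuous f := hf.continuous
  have i1 : IntegrableOn (fun x => (f x - m) ^ 2 * exp (-U x)) (closedBall x0 R) :=
    ContinuousOn.integrableOn_compact (isCompact_closedBall _ _) (by fun_prop)
  have i2 : IntegrableOn (fun x => ‖fderiv ℝ f x‖ ^ 2 * exp (-U x)) (closedBall x0 R) :=
    ContinuousOn.integrableOn_compact (isCompact_closedBall _ _) (by fun_prop)
  simp_rw [← ENNReal.ofReal_mul (sq_nonneg _)] at hm
  rw [← ofReal_integral_eq_lintegral_ofReal i1 (ae_of_all _ fun x => by positivity),
    ← ofReal_integral_eq_lintegral_ofReal i2 (ae_of_all _ fun x => by positivity),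
    show (4:ℝ≥0∞) ^ d = ENNReal.ofReal (4 ^ d) by
      rw [ENNReal.ofReal_pow (by norm_num)]; norm_num,
    ← ENNReal.ofReal_mul (by positivity), ← ENNReal.ofReal_mul (by positivity)] at hm
  refine (ENNReal.ofReal_le_ofReal_iff (mul_nonneg (by positivity) ?_)).1 hm
  exact integral_nonneg fun x => by positivity

/-- for a convex `C²` potential with `min V = 0` and
`∫ exp(-V) < ∞`, the Poincaré constant of the Gibbs measure `μ_ε` is bounded below
uniformly in the low-temperature regime. -/
theorem logconcave_gibbs_poincare_temperature_independent
    {d : ℕ} (V : Euc d → ℝ) (hV : ContDiff ℝ 2 V)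
    (hconv : ConvexOn ℝ univ V)
    (hmin0 : ∀ x, 0 ≤ V x) (hmin : ∃ x, V x = 0)
    (hZ : Integrable (fun x => exp (-V x))) :
    ∃ c > (0 : ℝ), ∃ ε₀ > (0 : ℝ),
      ∀ ε : ℝ, 0 < ε → ε ≤ ε₀ → PoincareIneq (gibbs V ε) c := by
  obtain ⟨x0, hx0⟩ := hmin
  obtain ⟨R, hR, hgrow⟩ := aux_growth V hV.continuous hconv x0 hx0 hZ
  have hR0 : 0 < R := by linarith
  set C : ℝ := 2 * (d + 1) * (4 * R ^ 2 * 4 ^ d) + 4 with hC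
  have hCpos : 0 < C := by positivity
  refine ⟨1 / C, by positivity, min 1 (1 / (2 * (d + 1) * R)), by positivity, ?_⟩
  intro ε hε hεle f hf hf2 hgf2
  have hε1 : ε ≤ 1 := hεle.trans (min_le_left _ _)
  have hε2 : ε * (2 * (d + 1) * R) ≤ 1 := by
    have := hεle.trans (min_le_right _ _)
    rwa [le_div_iff₀ (by positivity)] at this
  set U : Euc d → ℝ := fun x => V x / ε with hUdef
  have hUC : ContDiff ℝ 1 U := (hV.of_le (by norm_num)).div_const ε
  have hUc : Continuous U := hUC.continuous
  have hU0 : ∀ x, 0 ≤ U x := fun x => div_nonneg (hmin0 x) hε.le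
  have hUx0 : U x0 = 0 := by simp [hUdef, hx0]
  have hUconv : ConvexOn ℝ univ U := by
    have := hconv.smul (c := ε⁻¹) (by positivity)
    refine this.congr fun x _ => ?_
    simp [hUdef, div_eq_inv_mul]
  have hUgrow : ∀ x, R ≤ ‖x - x0‖ → 2 * (d + 1) * ‖x - x0‖ ≤ U x := by
    intro x hx
    have h1 := hgrow x hx
    simp only [hUdef]
    rw [le_div_iff₀ hε]
    calc 2 * (d + 1) * ‖x - x0‖ * ε ≤ 2 * (d + 1) * (R * V x) * ε := by gcongr
      _ = ε * (2 * (d + 1) * R) * V x := by ring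
      _ ≤ 1 * V x := by gcongr; exact hmin0 x
      _ = V x := one_mul _
  have hw : ∀ x, exp (-V x / ε) = exp (-U x) := fun x => by simp only [hUdef, neg_div]
  have hwint : Integrable fun x => exp (-U x) := by
    refine hZ.mono' (by fun_prop) (ae_of_all _ fun x => ?_)
    rw [Real.norm_of_nonneg (exp_pos _).le]
    refine exp_le_exp.2 (neg_le_neg ?_)
    exact le_div_self (hmin0 x) hε hε1
  set Z := ∫ x, exp (-U x) with hZdef
  have hZpos : 0 < Z := integral_exp_pos hwint
  have hwm : Measurable fun x => ENNReal.ofReal (exp (-U x)) := by fun_prop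
  have hμ : gibbs V ε = (ENNReal.ofReal Z)⁻¹ •
      volume.withDensity fun x => ENNReal.ofReal (exp (-U x)) := by
    simp only [gibbs, hw, hZdef]
  have hZ0' : (ENNReal.ofReal Z)⁻¹ ≠ 0 := by simp
  have hZt' : (ENNReal.ofReal Z)⁻¹ ≠ ∞ := by simpa using hZpos
  set μ := gibbs V ε with hμdef
  have hprob : IsProbabilityMeasure μ := by
    constructor
    rw [hμ, Measure.smul_apply, withDensity_apply _ MeasurableSet.univ, setLIntegral_univ,
      ← ofReal_integral_eq_lintegral_ofReal hwint (ae_of_all _ fun x => (exp_pos _).le),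
      smul_eq_mul]
    exact ENNReal.inv_mul_cancel (by simpa using hZpos) ENNReal.ofReal_ne_top
  have hInt : ∀ h : Euc d → ℝ, ∫ x, h x ∂μ = Z⁻¹ * ∫ x, h x * exp (-U x) := by
    intro h
    rw [hμ, integral_smul_measure, integral_withDensity_eq_integral_toReal_smul hwm
      (ae_of_all _ fun x => ENNReal.ofReal_lt_top)]
    rw [ENNReal.toReal_inv, ENNReal.toReal_ofReal hZpos.le, smul_eq_mul]
    congr 2
    ext x
    rw [ENNReal.toReal_ofReal (exp_pos _).le, smul_eq_mul, mul_comm]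
  have hIff : ∀ h : Euc d → ℝ, Integrable h μ ↔ Integrable fun x => h x * exp (-U x) := by
    intro h
    rw [hμ, integrable_smul_measure hZ0' hZt', integrable_withDensity_iff_integrable_smul' hwm
      (ae_of_all _ fun x => ENNReal.ofReal_lt_top)]
    refine integrable_congr (ae_of_all _ fun x => ?_)
    simp only
    rw [ENNReal.toReal_ofReal (exp_pos _).le, smul_eq_mul, mul_comm]
  have hgrad : ∀ x, ‖gradient f x‖ = ‖fderiv ℝ f x‖ := fun x => by
    rw [gradient, LinearIsometryEquiv.norm_map]
  simp only [hgrad] at hgf2 ⊢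
  obtain ⟨m, hm⟩ := aux_ball_real U hUc hUconv hU0 x0 hUx0 R hR0 f hf
  have hfL : MemLp f 2 μ := (memLp_two_iff_integrable_sq hf.continuous.aestronglyMeasurable).2 hf2
  have hf1 : Integrable f μ := hfL.integrable (by norm_num)
  have hfm : ∀ a : ℝ, Integrable (fun x => (f x - a) ^ 2) μ := fun a =>
    (hfL.sub (memLp_const a)).integrable_sq
  set E := ∫ y, f y ∂μ with hE
  have hvar : ∫ x, (f x - E) ^ 2 ∂μ ≤ ∫ x, (f x - m) ^ 2 ∂μ := by
    have e : ∀ x, (f x - m) ^ 2 = (f x - E) ^ 2 + (2 * (E - m) * (f x - E) + (E - m) ^ 2) :=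
      fun x => by ring
    have j1 : Integrable (fun x => 2 * (E - m) * (f x - E)) μ :=
      (hf1.sub (integrable_const E)).const_mul _
    have j2 : Integrable (fun _ : Euc d => (E - m) ^ 2) μ := integrable_const _
    have j3 : Integrable (fun x => 2 * (E - m) * (f x - E) + (E - m) ^ 2) μ := j1.add j2
    have : ∫ x, (f x - m) ^ 2 ∂μ = (∫ x, (f x - E) ^ 2 ∂μ) + (E - m) ^ 2 := by
      simp_rw [e]
      rw [integral_add (hfm E) j3, integral_add j1 j2, integral_const_mul,
        integral_sub hf1 (integrable_const E), ← hE]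
      simp
    nlinarith [sq_nonneg (E - m)]
  refine hvar.trans ?_
  have k1 := (hIff _).1 (hfm m)
  have k2 := (hIff _).1 hgf2
  have hfd : ∀ x, fderiv ℝ (fun x => f x - m) x = fderiv ℝ f x := fun x => by
    rw [fderiv_sub_const]
  have hly := aux_lyap U hUC hUconv hU0 x0 hUx0 R hR hUgrow (fun x => f x - m)
    (hf.sub contDiff_const) k1 (by simpa only [hfd] using k2)
  simp only [hfd] at hly
  have hset : ∫ x in closedBall x0 R, ‖fderiv ℝ f x‖ ^ 2 * exp (-U x) ≤
      ∫ x, ‖fderiv ℝ f x‖ ^ 2 * exp (-U x) :=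
    setIntegral_le_integral k2 (ae_of_all _ fun x => by positivity)
  rw [hInt, hInt, one_div_one_div, mul_left_comm]
  refine mul_le_mul_of_nonneg_left ?_ (inv_nonneg.2 hZpos.le)
  refine hly.trans ?_
  set I := ∫ x, ‖fderiv ℝ f x‖ ^ 2 * exp (-U x) with hI
  have hm2 := hm.trans (mul_le_mul_of_nonneg_left hset (by positivity))
  have := mul_le_mul_of_nonneg_left hm2 (show (0:ℝ) ≤ 2 * (d + 1) by positivity)
  rw [hC]
  linarith
end
end
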